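/- arXiv:0911.1065 — 5 statements merged into one kernel-verified Lean document; each statement's English description precedes it below -/
import Mathlib

section
/- For every integer d ≥ 2, (d/(d-1))^d · Σ_{k=0}^{d} C(d,k) · d^{-k} · (-1)^k / ((d-1)k + d + 1) - d/(d+1)^2 < 1/(d+1). (That is, on every regular tree of degree d ≥ 2, the limiting density of the second layer is strictly smaller than the limiting density 1/(d+1) of the first layer.) -/
open intervalIntegral in
lemma sum_eq_int (d : ℕ) (hd : 2 ≤ d) :
    ∑ k ∈ Finset.range (d + 1), (d.choose k : ℝ) * ((d : ℝ) ^ k)⁻¹ * (-1) ^ k /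
        (((d : ℝ) - 1) * (k : ℝ) + (d : ℝ) + 1)
    = ∫ x in (0:ℝ)..1, x ^ d * (1 - x ^ (d - 1) / d) ^ d := by
  have h : ∀ x : ℝ, x ^ d * (1 - x ^ (d - 1) / d) ^ d =
      ∑ k ∈ Finset.range (d + 1), ((d.choose k : ℝ) * ((d : ℝ) ^ k)⁻¹ * (-1) ^ k) *
        x ^ ((d - 1) * k + d) := by
    intro x
    rw [sub_eq_neg_add, add_pow, Finset.mul_sum]
    refine Finset.sum_congr rfl fun k _ => ?_
    rw [neg_pow, div_pow, pow_add, pow_mul, one_pow, div_eq_mul_inv]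
    ring
  simp_rw [h]
  rw [intervalIntegral.integral_finsetSum]
  · refine Finset.sum_congr rfl fun k _ => ?_
    rw [intervalIntegral.integral_const_mul, integral_pow]
    have : ((d - 1 : ℕ) : ℝ) = (d : ℝ) - 1 := by
      rw [Nat.cast_sub (by omega)]; simp
    push_cast
    rw [this]
    simp
    ring
  · intro k _
    exact (by fun_prop : Continuous _).intervalIntegrable _ _

lemma A_lt (d : ℕ) (hd : 11 ≤ d) : ((d : ℝ) / ((d : ℝ) - 1)) ^ d < 3 := by
  obtain ⟨n, rfl⟩ : ∃ n, d = n + 1 := ⟨d - 1, by omega⟩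
  have hn : (10 : ℝ) ≤ n := by exact_mod_cast (by omega : 10 ≤ n)
  have hn0 : (0 : ℝ) < n := by linarith
  have e1 : ((n + 1 : ℕ) : ℝ) / (((n + 1 : ℕ) : ℝ) - 1) = 1 + 1 / (n : ℝ) := by
    push_cast
    rw [add_sub_cancel_right]
    field_simp
  have h1 : (1 + 1 / (n : ℝ)) ^ n ≤ Real.exp 1 := by
    have h2 : 1 + 1 / (n : ℝ) ≤ Real.exp (1 / n) := by
      linarith [Real.add_one_le_exp (1 / (n : ℝ))]
    calc (1 + 1 / (n : ℝ)) ^ n ≤ Real.exp (1 / n) ^ n := by gcongr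
      _ = Real.exp 1 := by
        rw [← Real.exp_nat_mul]; congr 1; field_simp
  have h3 : 1 / (n : ℝ) ≤ 1 / 10 := by gcongr
  have h4 := Real.exp_one_lt_d9
  have h5 : 0 < 1 / (n : ℝ) := by positivity
  rw [e1, pow_succ]
  have h6 : (1 + 1 / (n : ℝ)) ^ n * (1 + 1 / (n : ℝ)) ≤ Real.exp 1 * (1 + 1 / 10) := by
    gcongr
  linarith

lemma chord (d : ℕ) (hd : 2 ≤ d) (y : ℝ) (h0 : 0 ≤ y) (h1 : y ≤ 1) :
    ((d : ℝ) / ((d : ℝ) - 1)) ^ d * (1 - y / d) ^ d ≤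
      (1 - y) * ((d : ℝ) / ((d : ℝ) - 1)) ^ d + y := by
  have hd' : (2 : ℝ) ≤ d := by exact_mod_cast hd
  have hp : (0 : ℝ) < d - 1 := by linarith
  have hx : (d : ℝ) / ((d : ℝ) - 1) ∈ Set.Ici (0 : ℝ) := by
    simp only [Set.mem_Ici]; positivity
  have hy : (1 : ℝ) ∈ Set.Ici (0 : ℝ) := by simp
  have := (convexOn_pow d (𝕜 := ℝ)).2 hx hy (sub_nonneg.2 h1) h0 (by ring)
  simp only [smul_eq_mul, one_pow, mul_one] at this
  rw [← mul_pow]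
  have e : (d : ℝ) / ((d : ℝ) - 1) * (1 - y / d) = (1 - y) * ((d : ℝ) / ((d : ℝ) - 1)) + y := by
    have h2 : (d : ℝ) ≠ 0 := by linarith
    have h3 : (d : ℝ) - 1 ≠ 0 := hp.ne'
    field_simp
    ring
  rw [e]
  exact this

open intervalIntegral in
lemma big (d : ℕ) (hd : 11 ≤ d) :
    ((d : ℝ) / ((d : ℝ) - 1)) ^ d *
      ∑ k ∈ Finset.range (d + 1), (d.choose k : ℝ) * ((d : ℝ) ^ k)⁻¹ * (-1) ^ k /
        (((d : ℝ) - 1) * (k : ℝ) + (d : ℝ) + 1)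
    - (d : ℝ) / ((d : ℝ) + 1) ^ 2
    < 1 / ((d : ℝ) + 1) := by
  have hd' : (11 : ℝ) ≤ d := by exact_mod_cast hd
  rw [sum_eq_int d (by omega), ← intervalIntegral.integral_const_mul]
  have hA := A_lt d hd
  have hch := chord d (by omega)
  set A := ((d : ℝ) / ((d : ℝ) - 1)) ^ d with hAdef
  have hle : ∫ x in (0:ℝ)..1, A * (x ^ d * (1 - x ^ (d - 1) / d) ^ d) ≤
      ∫ x in (0:ℝ)..1, (A * x ^ d + (1 - A) * x ^ (d + (d - 1))) := by
    apply intervalIntegral.integral_mono_on (by norm_num)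
    · exact (by fun_prop : Continuous _).intervalIntegrable _ _
    · exact (by fun_prop : Continuous _).intervalIntegrable _ _
    · intro x hx
      have := hch (x ^ (d - 1)) (pow_nonneg hx.1 _) (pow_le_one₀ hx.1 hx.2)
      have h2 := mul_le_mul_of_nonneg_left this (pow_nonneg hx.1 d)
      rw [pow_add]
      nlinarith [h2]
  have hint : ∫ x in (0:ℝ)..1, (A * x ^ d + (1 - A) * x ^ (d + (d - 1)))
      = A / (d + 1) + (1 - A) / (2 * d) := by
    rw [intervalIntegral.integral_add, intervalIntegral.integral_const_mul,
      intervalIntegral.integral_const_mul, integral_pow, integral_pow]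
    · have : ((d - 1 : ℕ) : ℝ) = (d : ℝ) - 1 := by
        rw [Nat.cast_sub (by omega)]; simp
      push_cast
      rw [this]
      simp
      ring
    · exact (by fun_prop : Continuous _).intervalIntegrable _ _
    · exact (by fun_prop : Continuous _).intervalIntegrable _ _
  rw [hint] at hle
  have h1 : A / (d + 1) + (1 - A) / (2 * d) ≤ (2 * d - 1) / (d * (d + 1) : ℝ) := by
    have : (2 * d - 1) / (d * (d + 1) : ℝ) - (A / (d + 1) + (1 - A) / (2 * d))
        = (3 - A) * (d - 1) / (2 * d * (d + 1)) := by
      field_simp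
      ring
    have h2 : 0 ≤ (3 - A) * (d - 1) / (2 * d * (d + 1) : ℝ) := by
      apply div_nonneg
      · apply mul_nonneg <;> linarith
      · positivity
    linarith
  have h2 : (2 * d - 1) / (d * (d + 1) : ℝ) < 1 / ((d : ℝ) + 1) + (d : ℝ) / ((d : ℝ) + 1) ^ 2 := by
    have : 1 / ((d : ℝ) + 1) + (d : ℝ) / ((d : ℝ) + 1) ^ 2 - (2 * d - 1) / (d * (d + 1) : ℝ)
        = 1 / (d * (d + 1) ^ 2) := by
      field_simp
      ring
    have h3 : 0 < 1 / (d * (d + 1) ^ 2 : ℝ) := by positivity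
    linarith
  linarith

/-- For every integer `d ≥ 2`, the limiting second-layer density on the regular tree of degree
`d` is strictly smaller than the limiting first-layer density `1/(d+1)`. -/
theorem stmt_7 (d : ℕ) (hd : 2 ≤ d) :
    ((d : ℝ) / ((d : ℝ) - 1)) ^ d *
      ∑ k ∈ Finset.range (d + 1), (d.choose k : ℝ) * ((d : ℝ) ^ k)⁻¹ * (-1) ^ k /
        (((d : ℝ) - 1) * (k : ℝ) + (d : ℝ) + 1)
    - (d : ℝ) / ((d : ℝ) + 1) ^ 2
    < 1 / ((d : ℝ) + 1) := by
  rcases le_or_gt 11 d with h | h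
  · exact big d h
  · interval_cases d <;> norm_num [Finset.sum_range_succ, Nat.choose]
end

section
/- For every integer d ≥ 2, (1 - 1/d)^d > 2(d-1)(d+1) / ((3d-1)(2d+1)). -/
/-- For every integer `d ≥ 2`, `(1 - 1/d)^d > 2(d-1)(d+1)/((3d-1)(2d+1))`. -/
theorem stmt_10 (d : ℕ) (hd : 2 ≤ d) :
    (1 - 1 / (d : ℝ)) ^ d >
      2 * ((d : ℝ) - 1) * ((d : ℝ) + 1) / ((3 * (d : ℝ) - 1) * (2 * (d : ℝ) + 1)) := by
  by_cases h : d < 12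
  · interval_cases d <;> norm_num
  · obtain ⟨n, rfl⟩ : ∃ n, d = n + 1 := ⟨d - 1, by omega⟩
    have hn : (11 : ℝ) ≤ n := by exact_mod_cast (by omega : 11 ≤ n)
    have hx : (0 : ℝ) < n := by linarith
    push_cast
    set x : ℝ := (n : ℝ) with hxdef
    have e1 : (1 + 1 / x) ^ n < 2.7182818286 := by
      have h1 : (1 + 1 / x) ≤ Real.exp (1 / x) := by
        have := Real.add_one_le_exp (1 / x)
        linarith
      have h2 : (1 + 1 / x) ^ n ≤ Real.exp (1 / x) ^ n := by gcongr
      rw [← Real.exp_nat_mul, ← hxdef, mul_one_div_cancel hx.ne'] at h2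
      linarith [Real.exp_one_lt_d9]
    have e2 : 1 - 1 / (x + 1) = (1 + 1 / x)⁻¹ := by
      field_simp
      ring
    have e3 : (2.7182818286 : ℝ)⁻¹ < (1 - 1 / (x + 1)) ^ n := by
      rw [e2, inv_pow]
      exact inv_strictAnti₀ (by positivity) e1
    have e4 : 1 - 1 / (x + 1) = x / (x + 1) := by
      field_simp
      ring
    have e5 : 0 < x / (x + 1) := by positivity
    rw [pow_succ]
    have e6 := mul_lt_mul_of_pos_right e3 e5
    rw [← e4] at e6
    refine lt_of_le_of_lt ?_ e6
    rw [e4, inv_mul_eq_div, div_div, div_le_div_iff₀ (by nlinarith) (by positivity)]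
    have : 0 ≤ x * ((3 * (x + 1) - 1) * (2 * (x + 1) + 1) - 2 * (x+1+1) * ((x + 1) * 2.7182818286)) :=
      mul_nonneg hx.le (by nlinarith)
    nlinarith
end

section
/- Let a, b : ℕ → ℝ be nonnegative sequences with a_0 = a_1 = b_0 = b_1 = 0 and Σ_{k} a_k = Σ_{k} b_k = 1 (both series summable). Suppose that for every s with 0 < s < 1 one has Σ_{k} a_k s^k > Σ_{k} b_k s^k. Then for every t > 0, Σ_{k} a_k (1 - e^{-(k+1)t})/(k+1) > Σ_{k} b_k (1 - e^{-(k+1)t})/(k+1). (That is, if the degree distribution of random tree S has pointwise larger probability generating function on (0,1) than that of random tree T, then for all t > 0 the tree-averaged first-layer density of the multilayer parking process with screening on S exceeds that on T.) -/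
lemma aux_cont (a : ℕ → ℝ) (ha : ∀ k, 0 ≤ a k) (hsa : Summable a) (c : ℝ) (hc : 0 < c) :
    ContinuousOn (fun s : ℝ => ∑' k, a k * s ^ k) (Set.Icc c 1) := by
  refine continuousOn_tsum (u := a) (fun k => by fun_prop) hsa ?_
  intro k s hs
  have h0 : 0 ≤ s := hc.le.trans hs.1
  rw [Real.norm_of_nonneg (mul_nonneg (ha k) (pow_nonneg h0 k))]
  exact mul_le_of_le_one_right (ha k) (pow_le_one₀ h0 hs.2)

lemma aux_int (a : ℕ → ℝ) (ha : ∀ k, 0 ≤ a k) (hsa : Summable a) (t : ℝ) (ht : 0 < t) :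
    (∑' k : ℕ, a k * (1 - Real.exp (-((k : ℝ) + 1) * t)) / ((k : ℝ) + 1)) =
      ∫ s in (Real.exp (-t))..1, ∑' k, a k * s ^ k := by
  have hc : 0 < Real.exp (-t) := Real.exp_pos _
  have hc1 : Real.exp (-t) < 1 := by simpa using ht
  have hmem : ∀ s ∈ Set.uIoc (Real.exp (-t)) 1, ∀ k, ‖a k * s ^ k‖ ≤ a k := by
    intro s hs k
    rw [Set.uIoc_of_le hc1.le] at hs
    have h0 : 0 ≤ s := hc.le.trans hs.1.le
    rw [Real.norm_of_nonneg (mul_nonneg (ha k) (pow_nonneg h0 k))]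
    exact mul_le_of_le_one_right (ha k) (pow_le_one₀ h0 hs.2)
  have h := intervalIntegral.hasSum_integral_of_dominated_convergence
    (μ := MeasureTheory.volume) (a := Real.exp (-t)) (b := 1)
    (F := fun k s => a k * s ^ k) (f := fun s => ∑' k, a k * s ^ k)
    (fun k _ => a k)
    (fun k => (by fun_prop : Continuous fun s : ℝ => a k * s ^ k).aestronglyMeasurable)
    (fun k => Filter.Eventually.of_forall fun s hs => hmem s hs k)
    (Filter.Eventually.of_forall fun s _ => hsa)
    (by simp)
    (Filter.Eventually.of_forall fun s hs =>
      (Summable.of_norm_bounded hsa (hmem s hs)).hasSum)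
  rw [← h.tsum_eq]
  refine tsum_congr fun k => ?_
  rw [intervalIntegral.integral_const_mul, integral_pow, ← Real.exp_nat_mul, one_pow, mul_div_assoc]
  congr 4
  push_cast
  ring

/-- If the degree distribution `a` of random tree `S` has a pointwise larger probability
generating function on `(0,1)` than the degree distribution `b` of random tree `T`, then for
every `t > 0` the tree-averaged first-layer density on `S` exceeds that on `T`. -/
theorem stmt_12 (a b : ℕ → ℝ) (ha : ∀ k, 0 ≤ a k) (hb : ∀ k, 0 ≤ b k)
    (ha0 : a 0 = 0) (ha1 : a 1 = 0) (hb0 : b 0 = 0) (hb1 : b 1 = 0)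
    (hsa : Summable a) (hsb : Summable b)
    (hta : ∑' k, a k = 1) (htb : ∑' k, b k = 1)
    (hG : ∀ s : ℝ, 0 < s → s < 1 → (∑' k, a k * s ^ k) > ∑' k, b k * s ^ k) :
    ∀ t : ℝ, 0 < t →
      (∑' k : ℕ, a k * (1 - Real.exp (-((k : ℝ) + 1) * t)) / ((k : ℝ) + 1)) >
        ∑' k : ℕ, b k * (1 - Real.exp (-((k : ℝ) + 1) * t)) / ((k : ℝ) + 1) := by
  intro t ht
  have hc : 0 < Real.exp (-t) := Real.exp_pos _
  have hc1 : Real.exp (-t) < 1 := by simpa using ht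
  rw [aux_int a ha hsa t ht, aux_int b hb hsb t ht]
  refine intervalIntegral.integral_lt_integral_of_continuousOn_of_le_of_exists_lt hc1
    (aux_cont b hb hsb _ hc) (aux_cont a ha hsa _ hc) ?_
    ⟨Real.exp (-t), Set.left_mem_Icc.2 hc1.le, hG _ hc hc1⟩
  intro s hs
  rcases hs.2.eq_or_lt with h | h
  · subst h
    simp [hta, htb]
  · exact (hG s (hc.trans hs.1) h).le
end

section
/- Let a : ℕ → ℝ be a nonnegative sequence with a_0 = a_1 = 0 and Σ_k a_k = 1, and suppose the mean d := Σ_k k·a_k exists (the series is summable) with d finite. Then for every real t > 0, Σ_k a_k (1 - e^{-(k+1)t})/(k+1) ≥ (1 - e^{-(d+1)t})/(d+1). (That is, if a random tree S has average vertex degree d, then for any t > 0 the tree-averaged first-layer density of the multilayer parking process with screening on S is at least that on the regular tree of degree d.) -/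
theorem tangent_aux (x c t : ℝ) (hx : 0 < x) (hc : 0 < c) (ht : 0 ≤ t) :
    (1 - Real.exp (-c * t)) / c +
      (x - c) * ((c * t * Real.exp (-c * t) - 1 + Real.exp (-c * t)) / c ^ 2) ≤
      (1 - Real.exp (-x * t)) / x := by
  let g : ℝ → ℝ := fun t => (1 - Real.exp (-x * t)) / x - ((1 - Real.exp (-c * t)) / c +
      (x - c) * ((c * t * Real.exp (-c * t) - 1 + Real.exp (-c * t)) / c ^ 2))
  have he : ∀ y s : ℝ, HasDerivAt (fun s => Real.exp (-y * s)) (Real.exp (-y * s) * (-y)) s := by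
    intro y s
    have := ((hasDerivAt_id s).const_mul (-y)).exp
    simpa using this
  have hg : ∀ s, HasDerivAt g
      (Real.exp (-x * s) - Real.exp (-c * s) * (1 - (x - c) * s)) s := by
    intro s
    have h1 := ((he x s).const_sub 1).div_const x
    have h2 := ((he c s).const_sub 1).div_const c
    have h3 := (((((hasDerivAt_id s).const_mul c).mul (he c s)).sub_const 1).add
      (he c s)).div_const (c ^ 2)
    have h4 := h1.sub (h2.add (h3.const_mul (x - c)))
    refine h4.congr_deriv ?_
    simp only [id]
    field_simp
    ring
  have hm : Monotone g := by
    refine monotone_of_deriv_nonneg (fun s => (hg s).differentiableAt) (fun s => ?_)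
    rw [(hg s).deriv]
    have h1 : Real.exp (-x * s) = Real.exp (-c * s) * Real.exp (-((x - c) * s)) := by
      rw [← Real.exp_add]; congr 1; ring
    have h2 := Real.add_one_le_exp (-((x - c) * s))
    rw [h1, ← mul_sub]
    exact mul_nonneg (Real.exp_pos _).le (by linarith)
  have := hm ht
  simp only [g] at this
  norm_num at this
  simpa using this

/-- If a random tree has degree distribution `a` (supported on integers `≥ 2`) with finite mean
`d = Σ_k k a_k`, then for every `t > 0` the tree-averaged first-layer density on the random tree
is at least the first-layer density `(1 - e^{-(d+1)t})/(d+1)` on the regular tree of degree `d`. -/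
theorem stmt_15 (a : ℕ → ℝ) (ha : ∀ k, 0 ≤ a k) (ha0 : a 0 = 0) (ha1 : a 1 = 0)
    (hsa : Summable a) (hta : ∑' k, a k = 1)
    (hmean : Summable fun k : ℕ => (k : ℝ) * a k) (d : ℝ)
    (hd : d = ∑' k : ℕ, (k : ℝ) * a k) :
    ∀ t : ℝ, 0 < t →
      (∑' k : ℕ, a k * (1 - Real.exp (-((k : ℝ) + 1) * t)) / ((k : ℝ) + 1)) ≥
        (1 - Real.exp (-(d + 1) * t)) / (d + 1) := by
  intro t ht
  have hd0 : 0 ≤ d := hd ▸ tsum_nonneg fun k => mul_nonneg (Nat.cast_nonneg k) (ha k)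
  set F := (1 - Real.exp (-(d + 1) * t)) / (d + 1) with hF
  set m := ((d + 1) * t * Real.exp (-(d + 1) * t) - 1 + Real.exp (-(d + 1) * t)) / (d + 1) ^ 2
    with hm
  have hS : HasSum (fun k : ℕ => a k * (F - m * d) + m * ((k : ℝ) * a k)) F := by
    have h1 := (hta ▸ hsa.hasSum : HasSum a 1).mul_right (F - m * d)
    have h2 := (by rw [hd]; exact hmean.hasSum : HasSum (fun k : ℕ => (k : ℝ) * a k) d).mul_left m
    have := h1.add h2
    have e : 1 * (F - m * d) + m * d = F := by ring
    rwa [e] at this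
  have hL : Summable fun k : ℕ => a k * (1 - Real.exp (-((k : ℝ) + 1) * t)) / ((k : ℝ) + 1) := by
    refine Summable.of_nonneg_of_le (fun k => ?_) (fun k => ?_) hsa
    · have : Real.exp (-((k : ℝ) + 1) * t) ≤ 1 := by
        rw [Real.exp_le_one_iff]
        have : 0 ≤ ((k : ℝ) + 1) * t := by positivity
        linarith
      exact div_nonneg (mul_nonneg (ha k) (by linarith)) (by positivity)
    · rw [div_le_iff₀ (by positivity)]
      apply mul_le_mul_of_nonneg_left _ (ha k)
      have := Real.exp_pos (-((k : ℝ) + 1) * t)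
      have : (0 : ℝ) ≤ k := Nat.cast_nonneg k
      linarith
  rw [ge_iff_le, ← hS.tsum_eq]
  refine hS.summable.tsum_le_tsum (fun k => ?_) hL
  have h := tangent_aux ((k : ℝ) + 1) (d + 1) t (by positivity) (by positivity) ht.le
  rw [← hF, ← hm] at h
  have h' := mul_le_mul_of_nonneg_left h (ha k)
  rw [mul_div_assoc]
  refine le_trans (le_of_eq ?_) h'
  ring
end

section
/- Define A_1(t) = (7/4)e^{-3t} - 2e^{-4t} - 2te^{-4t} + (1/4)e^{-5t} + (1/2)te^{-5t}, A_2(t) = (67/48)e^{-3t} - 7e^{-4t} + (31/4)e^{-5t} + 4te^{-5t} - (7/3)e^{-6t} - 2te^{-6t} + (3/16)e^{-7t} + (1/4)te^{-7t}, A_3(t) = -(15/4)e^{-3t} + (7/4)te^{-3t} + 4e^{-4t} + 2te^{-4t} - (1/4)e^{-5t} - (1/4)te^{-5t}, and A_4(t) = -(49/16)e^{-3t} + (67/48)te^{-3t} + 7e^{-4t} - (39/8)e^{-5t} - 2te^{-5t} + e^{-6t} + (2/3)te^{-6t} - (1/16)e^{-7t} - (1/16)te^{-7t}. Then the function Y(t)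 = 34/735 - (1991/432)e^{-3t} + (235/144)te^{-3t} + 7e^{-4t} + 2te^{-4t} - (121/40)e^{-5t} - (3/2)te^{-5t} + (17/27)e^{-6t} + (4/9)te^{-6t} - (33/784)e^{-7t} - (5/112)te^{-7t} satisfies Y(0) = 0 and Y'(t) = 2A_1(t) + A_2(t) - 2A_3(t) - A_4(t) for every t ∈ ℝ; moreover Y(t) → 34/735 as t → ∞. -/
open Filter

theorem aux_dE (k t : ℝ) : HasDerivAt (fun t : ℝ => Real.exp (k * t)) (k * Real.exp (k * t)) t := by
  have h := ((hasDerivAt_id t).const_mul k).exp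
  exact h.congr_deriv (by simp only [id]; ring)

theorem aux_dT (k t : ℝ) : HasDerivAt (fun t : ℝ => t * Real.exp (k * t))
    (Real.exp (k * t) + t * (k * Real.exp (k * t))) t := by
  have h := (hasDerivAt_id t).mul (aux_dE k t)
  exact h.congr_deriv (by simp only [id]; ring)

theorem aux_lE (k : ℝ) (hk : k < 0) : Tendsto (fun t : ℝ => Real.exp (k * t)) atTop (nhds 0) :=
  Real.tendsto_exp_atBot.comp (tendsto_id.const_mul_atTop_of_neg hk)

theorem aux_lT (k : ℝ) (hk : k < 0) :
    Tendsto (fun t : ℝ => t * Real.exp (k * t)) atTop (nhds 0) := by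
  have h := (Real.tendsto_pow_mul_exp_neg_atTop_nhds_zero 1).comp
    (tendsto_id.const_mul_atTop (neg_pos.2 hk))
  have h2 := h.const_mul (-k)⁻¹
  rw [mul_zero] at h2
  refine h2.congr fun t => ?_
  have : k ≠ 0 := hk.ne
  simp only [Function.comp, id, pow_one, neg_mul, neg_neg]
  field_simp

/-- The probability `Y t` of the pattern `(0,1,0,1)'` satisfies `Y 0 = 0`,
`Y' t = 2A₁ t + A₂ t - 2A₃ t - A₄ t` for every `t`, and `Y t → 34/735` as `t → ∞`. -/
theorem stmt_19 (A₁ A₂ A₃ A₄ Y : ℝ → ℝ)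
    (hA₁ : ∀ t : ℝ, A₁ t = (7 / 4) * Real.exp (-3 * t) - 2 * Real.exp (-4 * t)
      - 2 * t * Real.exp (-4 * t) + (1 / 4) * Real.exp (-5 * t)
      + (1 / 2) * t * Real.exp (-5 * t))
    (hA₂ : ∀ t : ℝ, A₂ t = (67 / 48) * Real.exp (-3 * t) - 7 * Real.exp (-4 * t)
      + (31 / 4) * Real.exp (-5 * t) + 4 * t * Real.exp (-5 * t)
      - (7 / 3) * Real.exp (-6 * t) - 2 * t * Real.exp (-6 * t)
      + (3 / 16) * Real.exp (-7 * t) + (1 / 4) * t * Real.exp (-7 * t))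
    (hA₃ : ∀ t : ℝ, A₃ t = -(15 / 4) * Real.exp (-3 * t) + (7 / 4) * t * Real.exp (-3 * t)
      + 4 * Real.exp (-4 * t) + 2 * t * Real.exp (-4 * t)
      - (1 / 4) * Real.exp (-5 * t) - (1 / 4) * t * Real.exp (-5 * t))
    (hA₄ : ∀ t : ℝ, A₄ t = -(49 / 16) * Real.exp (-3 * t) + (67 / 48) * t * Real.exp (-3 * t)
      + 7 * Real.exp (-4 * t) - (39 / 8) * Real.exp (-5 * t) - 2 * t * Real.exp (-5 * t)
      + Real.exp (-6 * t) + (2 / 3) * t * Real.exp (-6 * t)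
      - (1 / 16) * Real.exp (-7 * t) - (1 / 16) * t * Real.exp (-7 * t))
    (hY : ∀ t : ℝ, Y t = 34 / 735 - (1991 / 432) * Real.exp (-3 * t)
      + (235 / 144) * t * Real.exp (-3 * t) + 7 * Real.exp (-4 * t)
      + 2 * t * Real.exp (-4 * t) - (121 / 40) * Real.exp (-5 * t)
      - (3 / 2) * t * Real.exp (-5 * t) + (17 / 27) * Real.exp (-6 * t)
      + (4 / 9) * t * Real.exp (-6 * t) - (33 / 784) * Real.exp (-7 * t)
      - (5 / 112) * t * Real.exp (-7 * t)) :
    Y 0 = 0 ∧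
    (∀ t : ℝ, HasDerivAt Y (2 * A₁ t + A₂ t - 2 * A₃ t - A₄ t) t) ∧
    Tendsto Y atTop (nhds (34 / 735)) := by
  refine ⟨by rw [hY]; norm_num, fun t => ?_, ?_⟩
  · have h := (((((((aux_dE (-3) t).const_mul (-1991 / 432 : ℝ)).add
      ((aux_dT (-3) t).const_mul (235 / 144 : ℝ))).add
      (((aux_dE (-4) t).const_mul (7 : ℝ)).add
      ((aux_dT (-4) t).const_mul (2 : ℝ)))).add
      (((aux_dE (-5) t).const_mul (-121 / 40 : ℝ)).add
      ((aux_dT (-5) t).const_mul (-3 / 2 : ℝ)))).add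
      (((aux_dE (-6) t).const_mul (17 / 27 : ℝ)).add
      ((aux_dT (-6) t).const_mul (4 / 9 : ℝ)))).add
      (((aux_dE (-7) t).const_mul (-33 / 784 : ℝ)).add
      ((aux_dT (-7) t).const_mul (-5 / 112 : ℝ)))).const_add (34 / 735 : ℝ)
    rw [hA₁, hA₂, hA₃, hA₄]
    refine (h.congr_deriv ?_).congr_of_eventuallyEq (Eventually.of_forall fun s => ?_)
    · ring
    · simp only [hY, Pi.add_apply]
      ring
  · have h := (((((((aux_lE (-3) (by norm_num)).const_mul (-1991 / 432 : ℝ)).add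
      ((aux_lT (-3) (by norm_num)).const_mul (235 / 144 : ℝ))).add
      (((aux_lE (-4) (by norm_num)).const_mul (7 : ℝ)).add
      ((aux_lT (-4) (by norm_num)).const_mul (2 : ℝ)))).add
      (((aux_lE (-5) (by norm_num)).const_mul (-121 / 40 : ℝ)).add
      ((aux_lT (-5) (by norm_num)).const_mul (-3 / 2 : ℝ)))).add
      (((aux_lE (-6) (by norm_num)).const_mul (17 / 27 : ℝ)).add
      ((aux_lT (-6) (by norm_num)).const_mul (4 / 9 : ℝ)))).add
      (((aux_lE (-7) (by norm_num)).const_mul (-33 / 784 : ℝ)).add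
      ((aux_lT (-7) (by norm_num)).const_mul (-5 / 112 : ℝ)))).const_add (34 / 735 : ℝ)
    simp only [mul_zero, add_zero] at h
    refine h.congr fun s => ?_
    rw [hY]
    ring
end
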